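/- arXiv:2602.18183 — 2 statements merged into one kernel-verified Lean document; each statement's English description precedes it below -/
import Mathlib

section
/- Let ρ̊ ∈ C¹(ℝⁿ∖{0};[0,∞)) be radially symmetric with ∫_{ℝⁿ} ρ̊(x)(1+|x|) dx < ∞ and ‖ρ̊‖_{L¹(ℝⁿ)} = 2n, and let B ∈ ℝ^{n×n} be symmetric positive definite with det B = 1. Define ρ(x) := ρ̊(Bx)|x|²/|Bx|² for x ≠ 0. Then ρ is even, its associated kernel satisfies J(x) = ρ̊(Bx)/|Bx|² for x ≠ 0, the momentum matrix satisfies M = B^{−2} (so A := √M = B^{−1}), and for every z_n ∈ ℝ and every Q ∈ SO(n) one has ∫_{ℝ^{n−1}} J(AQ(z', z_n)) z' dz' = 0. -/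
open MeasureTheory Filter Topology Matrix

noncomputable section

abbrev EV (n : ℕ) := EuclideanSpace ℝ (Fin n)

/-- The kernel `J(x) = ρ(x)/|x|²`. -/
def kernelJ {n : ℕ} (ρ : EV n → ℝ) (x : EV n) : ℝ := ρ x / ‖x‖ ^ 2

/-- The momentum matrix `M = (1/2)∫_{ℝⁿ} J(z) z ⊗ z dz`. -/
def momentum {n : ℕ} (ρ : EV n → ℝ) : Matrix (Fin n) (Fin n) ℝ :=
  Matrix.of fun i j => (1 / 2 : ℝ) * ∫ z : EV n, kernelJ ρ z * z i * z j

/-- Multiplication of a vector of `ℝⁿ` by a matrix. -/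
def mulVecE {m : ℕ} (Q : Matrix (Fin m) (Fin m) ℝ) (x : EV m) : EV m :=
  (WithLp.equiv 2 (Fin m → ℝ)).symm (Q.mulVec ((WithLp.equiv 2 (Fin m → ℝ)) x))

/-- The point `(z', zₙ) ∈ ℝⁿ` with first coordinates `z' ∈ ℝ^{n-1}` and last coordinate `zₙ`. -/
def snocE {n : ℕ} (z' : EV n) (t : ℝ) : EV (n + 1) :=
  (WithLp.equiv 2 (Fin (n + 1) → ℝ)).symm
    (Fin.snoc ((WithLp.equiv 2 (Fin n → ℝ)) z') t)

/-- The anisotropic density `ρ(x) = ρ̊(Bx) |x|²/|Bx|²`. -/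
def anisoRho {n : ℕ} (ρ0 : EV (n + 1) → ℝ) (B : Matrix (Fin (n + 1)) (Fin (n + 1)) ℝ) :
    EV (n + 1) → ℝ :=
  fun x => ρ0 (mulVecE B x) * (‖x‖ ^ 2 / ‖mulVecE B x‖ ^ 2)

theorem mulVecE_eq {m : ℕ} (Q : Matrix (Fin m) (Fin m) ℝ) (x : EV m) :
    mulVecE Q x = Matrix.toLpLin 2 2 Q x := rfl

theorem mulVecE_apply {m : ℕ} (Q : Matrix (Fin m) (Fin m) ℝ) (x : EV m) (i : Fin m) :
    mulVecE Q x i = ∑ k, Q i k * x k := rfl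

theorem mulVecE_mul {m : ℕ} (P Q : Matrix (Fin m) (Fin m) ℝ) (x : EV m) :
    mulVecE (P * Q) x = mulVecE P (mulVecE Q x) := by
  simp [mulVecE_eq, Matrix.toLpLin_mul_same]

theorem mulVecE_one {m : ℕ} (x : EV m) : mulVecE 1 x = x := by
  simp [mulVecE_eq]

theorem mulVecE_neg {m : ℕ} (Q : Matrix (Fin m) (Fin m) ℝ) (x : EV m) :
    mulVecE Q (-x) = -mulVecE Q x := by
  simp [mulVecE_eq]

theorem norm_mulVecE_orth {m : ℕ} (Q : Matrix (Fin m) (Fin m) ℝ) (hQ : Qᵀ * Q = 1) (x : EV m) :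
    ‖mulVecE Q x‖ = ‖x‖ := by
  have h : ‖mulVecE Q x‖ ^ 2 = ‖x‖ ^ 2 := by
    have h1 : ∀ y : EV m, ‖y‖ ^ 2 = y.ofLp ⬝ᵥ y.ofLp := by
      intro y
      rw [EuclideanSpace.real_norm_sq_eq]
      simp [dotProduct, sq]
    rw [h1, h1]
    change (Q *ᵥ x.ofLp) ⬝ᵥ (Q *ᵥ x.ofLp) = _
    rw [Matrix.dotProduct_mulVec, Matrix.vecMul_mulVec, hQ, Matrix.vecMul_one]
  exact (sq_eq_sq₀ (norm_nonneg _) (norm_nonneg _)).1 h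

theorem integral_mulVecE {m : ℕ} (B : Matrix (Fin m) (Fin m) ℝ) (hdet : B.det = 1)
    (F : EV m → ℝ) : ∫ z, F (mulVecE B z) = ∫ w, F w := by
  have hd : LinearMap.det (Matrix.toLpLin 2 2 B : EV m →ₗ[ℝ] EV m) = 1 := by
    rw [LinearMap.det_toLpLin, hdet]
  have hmap := MeasureTheory.Measure.map_linearMap_addHaar_eq_smul_addHaar
    (volume : Measure (EV m)) (f := Matrix.toLpLin 2 2 B) (by rw [hd]; exact one_ne_zero)
  rw [hd] at hmap
  simp only [inv_one, abs_one, ENNReal.ofReal_one, one_smul] at hmap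
  have hcont : Continuous (Matrix.toLpLin 2 2 B : EV m →ₗ[ℝ] EV m) :=
    LinearMap.continuous_of_finiteDimensional _
  have hinj : Function.Injective (Matrix.toLpLin 2 2 B : EV m →ₗ[ℝ] EV m) := by
    intro x y hxy
    have h2 : mulVecE B⁻¹ (mulVecE B x) = mulVecE B⁻¹ (mulVecE B y) := by
      rw [mulVecE_eq B, mulVecE_eq B, hxy]
    rwa [← mulVecE_mul, ← mulVecE_mul, Matrix.nonsing_inv_mul _ (by rw [hdet]; exact isUnit_one),
      mulVecE_one, mulVecE_one] at h2
  exact MeasurePreserving.integral_comp ⟨hcont.measurable, hmap⟩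
    (hcont.measurableEmbedding hinj) F

theorem kernelJ_aniso {n : ℕ} (ρ0 : EV (n + 1) → ℝ)
    (B : Matrix (Fin (n + 1)) (Fin (n + 1)) ℝ) (x : EV (n + 1)) :
    kernelJ (anisoRho ρ0 B) x = ρ0 (mulVecE B x) / ‖mulVecE B x‖ ^ 2 := by
  unfold kernelJ anisoRho
  by_cases hx : x = 0
  · subst hx
    simp [mulVecE_eq]
  · have : ‖x‖ ≠ 0 := norm_ne_zero_iff.2 hx
    field_simp

theorem integrable_kl {m : ℕ} (ρ0 : EV m → ℝ) (h : Integrable ρ0 volume) (k l : Fin m) :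
    Integrable (fun w : EV m => ρ0 w * (w k * w l / ‖w‖ ^ 2)) volume := by
  refine h.mul_bdd (c := 1) ?_ ?_
  · exact Measurable.aestronglyMeasurable (by fun_prop)
  · refine Filter.Eventually.of_forall fun w => ?_
    rw [norm_div, norm_mul, norm_pow, norm_norm]
    have h1 := PiLp.norm_apply_le w k
    have h2 := PiLp.norm_apply_le w l
    refine div_le_one_of_le₀ ?_ (by positivity)
    rw [sq]
    gcongr

theorem integral_off {m : ℕ} (ρ0 : EV m → ℝ)
    (hrad : ∀ x y : EV m, ‖x‖ = ‖y‖ → ρ0 x = ρ0 y) (k l : Fin m) (hkl : k ≠ l) :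
    ∫ w : EV m, ρ0 w * (w k * w l / ‖w‖ ^ 2) = 0 := by
  let e : EV m ≃ₗᵢ[ℝ] EV m := LinearIsometryEquiv.piLpCongrRight 2
    (fun i => if i = k then LinearIsometryEquiv.neg ℝ else LinearIsometryEquiv.refl ℝ ℝ)
  have h := e.measurePreserving.integral_comp e.toHomeomorph.measurableEmbedding
    (fun w : EV m => ρ0 w * (w k * w l / ‖w‖ ^ 2))
  have h1 : ∀ w : EV m, e w k = - w k := by intro w; simp [e]
  have h2 : ∀ w : EV m, e w l = w l := by intro w; simp [e, hkl.symm]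
  have h3 : ∀ w : EV m, ρ0 (e w) = ρ0 w := fun w => hrad _ _ (e.norm_map w)
  simp only [h1, h2, h3, LinearIsometryEquiv.norm_map, neg_mul, neg_div, mul_neg] at h
  rw [integral_neg] at h
  linarith

theorem integral_diag_eq {m : ℕ} (ρ0 : EV m → ℝ)
    (hrad : ∀ x y : EV m, ‖x‖ = ‖y‖ → ρ0 x = ρ0 y) (k l : Fin m) :
    ∫ w : EV m, ρ0 w * (w k * w k / ‖w‖ ^ 2) = ∫ w : EV m, ρ0 w * (w l * w l / ‖w‖ ^ 2) := by
  let e : EV m ≃ₗᵢ[ℝ] EV m := LinearIsometryEquiv.piLpCongrLeft 2 ℝ ℝ (Equiv.swap k l)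
  have h := e.measurePreserving.integral_comp e.toHomeomorph.measurableEmbedding
    (fun w : EV m => ρ0 w * (w l * w l / ‖w‖ ^ 2))
  have h1 : ∀ w : EV m, e w l = w k := by
    intro w
    simp [e, LinearIsometryEquiv.piLpCongrLeft_apply, Equiv.piCongrLeft']
  have h3 : ∀ w : EV m, ρ0 (e w) = ρ0 w := fun w => hrad _ _ (e.norm_map w)
  simp only [h1, h3, LinearIsometryEquiv.norm_map] at h
  exact h

theorem integral_kl {n : ℕ} (ρ0 : EV (n + 1) → ℝ) (hi : Integrable ρ0 volume)
    (hrad : ∀ x y : EV (n + 1), ‖x‖ = ‖y‖ → ρ0 x = ρ0 y)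
    (hL1 : ∫ x : EV (n + 1), ρ0 x = 2 * ((n : ℝ) + 1)) (k l : Fin (n + 1)) :
    ∫ w : EV (n + 1), ρ0 w * (w k * w l / ‖w‖ ^ 2) = if k = l then 2 else 0 := by
  split_ifs with hkl
  · subst hkl
    have hs : ∑ j, ∫ w : EV (n + 1), ρ0 w * (w j * w j / ‖w‖ ^ 2) = 2 * ((n : ℝ) + 1) := by
      rw [← integral_finsetSum _ (fun j _ => integrable_kl ρ0 hi j j), ← hL1]
      refine integral_congr_ae ?_
      filter_upwards [Measure.ae_ne volume (0 : EV (n + 1))] with w hw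
      rw [← Finset.mul_sum, ← Finset.sum_div]
      have : ∑ j, w j * w j = ‖w‖ ^ 2 := by
        rw [EuclideanSpace.real_norm_sq_eq]; simp [sq]
      rw [this, div_self (pow_ne_zero 2 (norm_ne_zero_iff.2 hw)), mul_one]
    rw [Finset.sum_congr rfl (fun j _ => integral_diag_eq ρ0 hrad j k)] at hs
    simp only [Finset.sum_const, Finset.card_univ, Fintype.card_fin, nsmul_eq_mul] at hs
    push_cast at hs
    have hn : ((n : ℝ) + 1) ≠ 0 := by positivity
    apply mul_left_cancel₀ hn
    linarith
  · exact integral_off ρ0 hrad k l hkl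

/-- construction of anisotropic kernels: if `ρ̊` is a radially symmetric
`C¹(ℝⁿ∖{0})` density with `∫ ρ̊(x)(1+|x|) dx < ∞` and `‖ρ̊‖_{L¹} = 2n`, and `B` is symmetric
positive definite with `det B = 1`, then `ρ(x) := ρ̊(Bx)|x|²/|Bx|²` is even, its kernel is
`J(x) = ρ̊(Bx)/|Bx|²`, its momentum matrix is `M = B⁻²` (so `A = √M = B⁻¹`), and
`∫_{ℝ^{n-1}} J(AQ(z', zₙ)) z' dz' = 0` for all `zₙ ∈ ℝ` and all `Q ∈ SO(n)`.
(The ambient dimension is `n + 1` with `n ∈ ℕ` arbitrary, so that `ℝ^{n-1}` makes sense.) -/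
theorem anisotropic_kernel_construction (n : ℕ) (ρ0 : EV (n + 1) → ℝ)
    (hreg : ContDiffOn ℝ 1 ρ0 {(0 : EV (n + 1))}ᶜ) (hpos : ∀ x, 0 ≤ ρ0 x)
    (hrad : ∀ x y : EV (n + 1), ‖x‖ = ‖y‖ → ρ0 x = ρ0 y)
    (hint : Integrable (fun x : EV (n + 1) => ρ0 x * (1 + ‖x‖)) volume)
    (hL1 : ∫ x : EV (n + 1), ρ0 x = 2 * ((n : ℝ) + 1))
    (B : Matrix (Fin (n + 1)) (Fin (n + 1)) ℝ) (hB : B.PosDef) (hdet : B.det = 1) :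
    (∀ x : EV (n + 1), anisoRho ρ0 B (-x) = anisoRho ρ0 B x) ∧
    (∀ x : EV (n + 1), x ≠ 0 →
      kernelJ (anisoRho ρ0 B) x = ρ0 (mulVecE B x) / ‖mulVecE B x‖ ^ 2) ∧
    momentum (anisoRho ρ0 B) = B⁻¹ * B⁻¹ ∧
    (∀ t : ℝ, ∀ Q : Matrix (Fin (n + 1)) (Fin (n + 1)) ℝ, Qᵀ * Q = 1 → Q.det = 1 →
      (∫ z' : EV n, kernelJ (anisoRho ρ0 B) (mulVecE (B⁻¹ * Q) (snocE z' t)) • z') = 0) := by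
  have hu : IsUnit B.det := by rw [hdet]; exact isUnit_one
  have hi : Integrable ρ0 volume := by
    by_contra hc
    rw [integral_undef hc] at hL1
    have : (0 : ℝ) < 2 * ((n : ℝ) + 1) := by positivity
    linarith
  refine ⟨?_, fun x _ => kernelJ_aniso ρ0 B x, ?_, ?_⟩
  · intro x
    unfold anisoRho
    rw [mulVecE_neg, norm_neg, norm_neg, hrad _ (mulVecE B x) (norm_neg _)]
  · have hsym : (B⁻¹)ᵀ = B⁻¹ := by
      have := hB.isHermitian.inv
      simpa [Matrix.IsHermitian, Matrix.conjTranspose_eq_transpose_of_trivial] using this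
    ext i j
    have key : ∀ z : EV (n + 1), kernelJ (anisoRho ρ0 B) z * z i * z j =
        (fun w : EV (n + 1) => ∑ k, ∑ l, B⁻¹ i k * B⁻¹ j l * (ρ0 w * (w k * w l / ‖w‖ ^ 2)))
          (mulVecE B z) := by
      intro z
      have hz : z = mulVecE B⁻¹ (mulVecE B z) := by
        rw [← mulVecE_mul, Matrix.nonsing_inv_mul _ hu, mulVecE_one]
      rw [kernelJ_aniso]
      conv_lhs => rw [show z i = mulVecE B⁻¹ (mulVecE B z) i by rw [← hz],
        show z j = mulVecE B⁻¹ (mulVecE B z) j by rw [← hz]]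
      generalize mulVecE B z = w
      rw [mulVecE_apply, mulVecE_apply, mul_assoc, Finset.sum_mul_sum, Finset.mul_sum]
      refine Finset.sum_congr rfl fun k _ => ?_
      rw [Finset.mul_sum]
      refine Finset.sum_congr rfl fun l _ => ?_
      ring
    unfold momentum
    rw [Matrix.of_apply]
    simp_rw [key]
    rw [integral_mulVecE B hdet (fun w : EV (n + 1) =>
      ∑ k, ∑ l, B⁻¹ i k * B⁻¹ j l * (ρ0 w * (w k * w l / ‖w‖ ^ 2)))]
    rw [integral_finsetSum _ (fun k _ => integrable_finsetSum _
      (fun l _ => (integrable_kl ρ0 hi k l).const_mul _))]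
    have : ∀ k, ∫ w : EV (n + 1), ∑ l, B⁻¹ i k * B⁻¹ j l * (ρ0 w * (w k * w l / ‖w‖ ^ 2))
        = 2 * (B⁻¹ i k * B⁻¹ k j) := by
      intro k
      rw [integral_finsetSum _ (fun l _ => (integrable_kl ρ0 hi k l).const_mul _)]
      simp_rw [integral_const_mul, integral_kl ρ0 hi hrad hL1]
      have hjk : B⁻¹ j k = B⁻¹ k j := by
        conv_lhs => rw [← hsym]
        rfl
      simp [hjk]
      ring
    simp_rw [this]
    rw [← Finset.mul_sum, Matrix.mul_apply]
    ring
  · intro t Q hQ _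
    have hn : ∀ z' : EV n, ‖snocE (-z') t‖ = ‖snocE z' t‖ := by
      intro z'
      have : ∀ y : EV n, ‖snocE y t‖ ^ 2 = ‖y‖ ^ 2 + t ^ 2 := by
        intro y
        rw [EuclideanSpace.real_norm_sq_eq, EuclideanSpace.real_norm_sq_eq, Fin.sum_univ_castSucc]
        simp [snocE]
      refine (sq_eq_sq₀ (norm_nonneg _) (norm_nonneg _)).1 ?_
      rw [this, this, norm_neg]
    have hJ : ∀ z' : EV n, kernelJ (anisoRho ρ0 B) (mulVecE (B⁻¹ * Q) (snocE z' t)) =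
        ρ0 (snocE z' t) / ‖snocE z' t‖ ^ 2 := by
      intro z'
      rw [kernelJ_aniso, ← mulVecE_mul, ← Matrix.mul_assoc, Matrix.mul_nonsing_inv _ hu,
        Matrix.one_mul, norm_mulVecE_orth Q hQ, hrad _ _ (norm_mulVecE_orth Q hQ _)]
    simp_rw [hJ]
    have h := integral_neg_eq_self
      (fun z' : EV n => (ρ0 (snocE z' t) / ‖snocE z' t‖ ^ 2) • z') volume
    simp only [hn, fun z' : EV n => hrad _ _ (hn z'), smul_neg] at h
    rw [integral_neg] at h
    have h2 := eq_neg_iff_add_eq_zero.1 h.symm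
    rw [← two_smul ℝ] at h2
    exact (smul_eq_zero.1 h2).resolve_left two_ne_zero
end
end

section
/- Let p ∈ [1,∞), ε > 0 and u ∈ C_c²(ℝⁿ). Then for almost every x ∈ ℝⁿ the principal value lim_{r→0⁺} ∫_{{|x−y| ≥ r}} J_ε(x−y)(u(x) − u(y)) dy exists and equals L_ε u(x) := ∫_{ℝⁿ} J_ε(x−y)(u(x) − u(y) − ∇u(x)·(x−y)) dy. -/
open MeasureTheory Filter Topology ENNReal

noncomputable section

/-- The rescaled density `ρ_ε(x) = ε^{-n} ρ(x/ε)`. -/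
def scaled {n : ℕ} (ρ : EV n → ℝ) (ε : ℝ) (x : EV n) : ℝ := (ε ^ n)⁻¹ * ρ (ε⁻¹ • x)

/-- Assumption (A1): `ρ` is measurable, nonnegative, not a.e. zero, even,
and `∫ ρ(x)(1+|x|) dx < ∞`. -/
def A1 {n : ℕ} (ρ : EV n → ℝ) : Prop :=
  Measurable ρ ∧ (∀ x, 0 ≤ ρ x) ∧ ¬ (ρ =ᵐ[volume] (fun _ => (0 : ℝ))) ∧
  (∀ᵐ x : EV n ∂volume, ρ (-x) = ρ x) ∧
  Integrable (fun x : EV n => ρ x * (1 + ‖x‖)) volume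

/-- `L_ε u (x) = ∫_{ℝⁿ} J_ε(x-y) (u(x) - u(y) - ∇u(x)·(x-y)) dy`. -/
def nlOp {n : ℕ} (ρ : EV n → ℝ) (ε : ℝ) (u : EV n → ℝ) (x : EV n) : ℝ :=
  ∫ y : EV n, kernelJ (scaled ρ ε) (x - y) * (u x - u y - fderiv ℝ u x (x - y))

/-- The classical partial derivative `∂ᵢ u`. -/
def partialD {n : ℕ} (i : Fin n) (u : EV n → ℝ) : EV n → ℝ :=
  fun x => fderiv ℝ u x (EuclideanSpace.single i 1)

/-- Iterated classical partial derivatives along a list of directions. -/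
def partialDList {n : ℕ} : List (Fin n) → (EV n → ℝ) → (EV n → ℝ)
  | [], u => u
  | i :: l, u => partialD i (partialDList l u)

/-- principal-value representation: for `u ∈ C_c²(ℝⁿ)`, for a.e.
`x ∈ ℝⁿ` the principal value `lim_{r→0⁺} ∫_{|x-y| ≥ r} J_ε(x-y)(u(x)-u(y)) dy` exists
and equals `L_ε u (x)`. -/
theorem nlOp_eq_principal_value (n : ℕ) (hn : 1 ≤ n) (ρ : EV n → ℝ) (hρ : A1 ρ)
    (p : ℝ≥0∞) (hp1 : 1 ≤ p) (hp : p ≠ ⊤) (ε : ℝ) (hε : 0 < ε)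
    (u : EV n → ℝ) (hu : ContDiff ℝ 2 u) (hsupp : HasCompactSupport u) :
    ∀ᵐ x : EV n ∂volume,
      Tendsto
        (fun r : ℝ =>
          ∫ y in {y : EV n | r ≤ dist x y}, kernelJ (scaled ρ ε) (x - y) * (u x - u y))
        (𝓝[>] 0) (𝓝 (nlOp ρ ε u x)) := by
  obtain ⟨hm, hnn, -, heven, hint⟩ := hρ
  refine Filter.Eventually.of_forall fun x => ?_
  have hρi : Integrable ρ volume := by
    refine hint.mono hm.aestronglyMeasurable (Eventually.of_forall fun z => ?_)
    rw [Real.norm_of_nonneg (hnn z),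
      Real.norm_of_nonneg (mul_nonneg (hnn z) (by positivity))]
    nlinarith [hnn z, norm_nonneg z, mul_nonneg (hnn z) (norm_nonneg z)]
  have hε0 : ε⁻¹ ≠ 0 := inv_ne_zero hε.ne'
  obtain ⟨R, hR⟩ : ∃ R, R = scaled ρ ε := ⟨_, rfl⟩
  have hRm : Measurable R := by
    rw [hR]; unfold scaled
    exact (hm.comp (measurable_const_smul ε⁻¹)).const_mul _
  have hRn : ∀ z, 0 ≤ R z := by
    intro z; rw [hR]; unfold scaled
    exact mul_nonneg (by positivity) (hnn _)
  have hRi : Integrable R volume := by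
    rw [hR]; unfold scaled
    exact (hρi.comp_smul hε0).const_mul _
  have hRe : ∀ᵐ z : EV n ∂volume, R (-z) = R z := by
    have := (Measure.quasiMeasurePreserving_smul (volume : Measure (EV n)) hε0).ae heven
    filter_upwards [this] with z hz
    rw [hR]; unfold scaled
    rw [smul_neg, hz]
  unfold nlOp
  rw [← hR]
  have hJm : Measurable (kernelJ R) := by
    unfold kernelJ
    exact hRm.div (measurable_norm.pow_const 2)
  have hsub : Measurable (fun y : EV n => x - y) := measurable_const.sub measurable_id
  have hJm' : Measurable (fun y : EV n => kernelJ R (x - y)) := hJm.comp hsub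
  have hRi' : Integrable (fun y : EV n => R (x - y)) volume := hRi.comp_sub_left x
  obtain ⟨D, hD⟩ : ∃ D, D = fderiv ℝ u x := ⟨_, rfl⟩
  rw [← hD]
  -- Taylor bound
  obtain ⟨K, hK⟩ := ContDiff.lipschitzWith_of_hasCompactSupport (𝕂 := ℝ) (n := 1)
    (hsupp.fderiv ℝ) (hu.fderiv_right (by norm_num)) (by norm_num)
  have hT : ∀ y, |u x - u y - D (x - y)| ≤ K * ‖x - y‖ ^ 2 := by
    intro y
    have := (convex_closedBall x ‖x - y‖).norm_image_sub_le_of_norm_fderiv_le' (𝕜 := ℝ) (f := u)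
      (φ := D) (C := K * ‖x - y‖) (x := y) (y := x)
      (fun z _ => (hu.differentiable (by norm_num)) z) (fun z hz => by
        rw [hD, ← dist_eq_norm]
        exact (hK.dist_le_mul z x).trans
          (mul_le_mul_of_nonneg_left (Metric.mem_closedBall.1 hz) K.2))
      (by simp [dist_eq_norm, norm_sub_rev]) (by simp)
    rw [Real.norm_eq_abs] at this
    linarith
  let F : EV n → ℝ := fun y => kernelJ R (x - y) * (u x - u y - D (x - y))
  have hFm : Measurable F :=
    hJm'.mul ((measurable_const.sub hu.continuous.measurable).sub
      (D.continuous.measurable.comp hsub))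
  have hFb : ∀ y, ‖F y‖ ≤ K * R (x - y) := by
    intro y
    rw [Real.norm_eq_abs]
    simp only [F, kernelJ, abs_mul, abs_div]
    rw [abs_of_nonneg (hRn _), abs_of_nonneg (by positivity : (0:ℝ) ≤ ‖x - y‖ ^ 2)]
    rcases eq_or_ne (x - y) 0 with h | h
    · rw [h]; simpa using mul_nonneg K.2 (hRn 0)
    · have h2 : 0 < ‖x - y‖ ^ 2 := by have := norm_pos_iff.2 h; positivity
      calc R (x - y) / ‖x - y‖ ^ 2 * |u x - u y - D (x - y)|
          ≤ R (x - y) / ‖x - y‖ ^ 2 * (K * ‖x - y‖ ^ 2) :=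
            mul_le_mul_of_nonneg_left (hT y) (div_nonneg (hRn _) h2.le)
        _ = K * R (x - y) := by field_simp
  have hFi : Integrable F volume :=
    (hRi'.const_mul (K : ℝ)).mono' hFm.aestronglyMeasurable (Eventually.of_forall hFb)
  have hSm : ∀ r : ℝ, MeasurableSet {y : EV n | r ≤ dist x y} := fun r =>
    (isClosed_le continuous_const (continuous_const.dist continuous_id)).measurableSet
  have hlim : Tendsto (fun r : ℝ => ∫ y, Set.indicator {y : EV n | r ≤ dist x y} F y)
      (𝓝[>] 0) (𝓝 (∫ y, F y)) := by
    refine tendsto_integral_filter_of_dominated_convergence (fun y => K * R (x - y))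
      (Eventually.of_forall fun r => (hFm.indicator (hSm r)).aestronglyMeasurable)
      (Eventually.of_forall fun r => Eventually.of_forall fun y =>
        (norm_indicator_le_norm_self _ _).trans (hFb y))
      (hRi'.const_mul (K : ℝ)) (Eventually.of_forall fun y => ?_)
    refine tendsto_const_nhds.congr' ?_
    rcases eq_or_ne x y with h | h
    · have : F y = 0 := by simp [F, h]
      exact Eventually.of_forall fun r => by simp [Set.indicator_apply, this]
    · have h0 : 0 < dist x y := dist_pos.2 h
      filter_upwards [Ioo_mem_nhdsGT h0] with r hr
      rw [Set.indicator_of_mem]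
      exact hr.2.le
  refine hlim.congr' ?_
  filter_upwards [self_mem_nhdsWithin] with r hr
  have hr : 0 < r := hr
  rw [← integral_indicator (hSm r)]
  let H : EV n → ℝ := Set.indicator {z : EV n | r ≤ ‖z‖} (fun z => kernelJ R z * D z)
  have hHm : Measurable H :=
    (hJm.mul D.continuous.measurable).indicator
      (isClosed_le continuous_const continuous_norm).measurableSet
  have hHi : Integrable H volume := by
    refine (hRi.const_mul (‖D‖ / r)).mono' hHm.aestronglyMeasurable
      (Eventually.of_forall fun z => ?_)
    by_cases hz : r ≤ ‖z‖
    · have hz0 : 0 < ‖z‖ := hr.trans_le hz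
      have : H z = kernelJ R z * D z := Set.indicator_of_mem (by exact hz) _
      rw [this, norm_mul, kernelJ, norm_div, Real.norm_of_nonneg (hRn z),
        Real.norm_of_nonneg (by positivity : (0:ℝ) ≤ ‖z‖ ^ 2)]
      calc R z / ‖z‖ ^ 2 * ‖D z‖ ≤ R z / ‖z‖ ^ 2 * (‖D‖ * ‖z‖) :=
            mul_le_mul_of_nonneg_left (D.le_opNorm z) (div_nonneg (hRn z) (by positivity))
        _ = ‖D‖ / ‖z‖ * R z := by field_simp
        _ ≤ ‖D‖ / r * R z := by
            refine mul_le_mul_of_nonneg_right ?_ (hRn z)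
            exact div_le_div_of_nonneg_left (norm_nonneg D) hr hz
    · have : H z = 0 := Set.indicator_of_notMem (by exact hz) _
      rw [this, norm_zero]
      exact mul_nonneg (by positivity) (hRn z)
  have hH0 : ∫ z, H z = 0 := by
    have h1 : ∫ z, H (-z) = ∫ z, H z := integral_neg_eq_self H volume
    have h2 : ∫ z, H (-z) = ∫ z, -H z := by
      refine integral_congr_ae ?_
      filter_upwards [hRe] with z hz
      simp only [H, Set.indicator_apply, Set.mem_setOf_eq, norm_neg, kernelJ, hz, map_neg]
      split_ifs <;> simp
    rw [integral_neg] at h2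
    linarith
  have hH0' : ∫ y, H (x - y) = 0 := by
    rw [integral_sub_left_eq_self H volume x, hH0]
  have hsum : ∀ y, Set.indicator {y : EV n | r ≤ dist x y}
      (fun y => kernelJ R (x - y) * (u x - u y)) y =
      Set.indicator {y : EV n | r ≤ dist x y} F y + H (x - y) := by
    intro y
    simp only [H, F, Set.indicator_apply, Set.mem_setOf_eq, dist_eq_norm]
    split_ifs
    · ring
    · simp
  simp_rw [hsum]
  rw [integral_add (hFi.indicator (hSm r)) (hHi.comp_sub_left x), hH0', add_zero]
end
end
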